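/- arXiv:2002.08626 — 4 statements merged into one kernel-verified Lean document; each statement's English description precedes it below -/
import Mathlib

section
/- Let q be a prime power and F a finite field with q elements, let n ≥ 1, and let Z be a nonempty subset of the vector space F^n. Then there exists an affine subspace H of F^n whose codimension n − dim(H) is at most log_q(|Z|) + q·log_2(q) and such that Z ∩ H contains exactly one point. -/
/-- A set of fewer than `|F| ^ k` nonzero vectors is avoided by the kernel of some linear map
to `F ^ k`. -/
theorem exists_linearMap_forall_apply_ne_zero {F V : Type*} [Field F] [Finite F]
    [AddCommGroup V] [Module F V] [Finite V] (k : ℕ) (S : Finset V)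
    (hS : ∀ v ∈ S, v ≠ 0) (hcard : S.card < Nat.card F ^ k) :
    ∃ L : V →ₗ[F] (Fin k → F), ∀ v ∈ S, L v ≠ 0 := by
  classical
  have : Finite (V →ₗ[F] (Fin k → F)) := Finite.of_injective _ DFunLike.coe_injective
  have := Fintype.ofFinite (V →ₗ[F] (Fin k → F))
  have card_vanishing : ∀ v ∈ S,
      Nat.card F ^ k * (Finset.univ.filter fun L : V →ₗ[F] (Fin k → F) => L v = 0).card =
        Nat.card (V →ₗ[F] (Fin k → F)) := by
    intro v hv
    let ev : (V →ₗ[F] (Fin k → F)) →ₗ[F] (Fin k → F) := LinearMap.applyₗ v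
    have hsurj : Function.Surjective ev := by
      intro w
      obtain ⟨f, hf⟩ := Module.Projective.exists_dual_ne_zero F (hS v hv)
      exact ⟨f.smulRight ((f v)⁻¹ • w), by simp [ev, smul_smul, hf]⟩
    rw [Submodule.card_eq_card_quotient_mul_card (LinearMap.ker ev),
      Nat.card_congr (ev.quotKerEquivOfSurjective hsurj).toEquiv, Nat.card_fun, Nat.card_fin,
      ← Nat.subtype_card (p := fun L => L ∈ LinearMap.ker ev) _ (by simp [ev])]
    ring
  by_contra! hzero
  have hcover : (Finset.univ : Finset (V →ₗ[F] (Fin k → F))) ⊆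
      S.biUnion fun v => Finset.univ.filter fun L => L v = 0 := by
    intro L _
    simpa using hzero L
  have hunion : Nat.card F ^ k * Nat.card (V →ₗ[F] (Fin k → F)) ≤
      S.card * Nat.card (V →ₗ[F] (Fin k → F)) := by
    calc _ ≤ Nat.card F ^ k *
          ∑ v ∈ S, (Finset.univ.filter fun L : V →ₗ[F] (Fin k → F) => L v = 0).card := by
          rw [Nat.card_eq_fintype_card (α := V →ₗ[F] (Fin k → F)), ← Finset.card_univ]
          gcongr
          exact (Finset.card_le_card hcover).trans Finset.card_biUnion_le
      _ = _ := by rw [Finset.mul_sum, Finset.sum_congr rfl card_vanishing]; simp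
  exact hcard.not_ge (Nat.le_of_mul_le_mul_right hunion Nat.card_pos)

/-- Let `q` be a prime power and `F` a finite field with `q` elements,
let `n ≥ 1`, and let `Z` be a nonempty subset of the vector space `F^n`.  Then there is an
affine subspace `H` of `F^n` whose codimension `n - dim H` is at most
`log_q |Z| + q·log₂ q` and such that `Z ∩ H` contains exactly one point. -/
theorem affine_subspace_single_point_of_small_codim
    {F : Type*} [Field F] [Fintype F] (q : ℕ) (hq : Fintype.card F = q)
    (n : ℕ) (hn : 1 ≤ n) (Z : Set (Fin n → F)) (hZ : Z.Nonempty) :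
    ∃ H : AffineSubspace F (Fin n → F),
      (∃! x, x ∈ Z ∩ (H : Set (Fin n → F))) ∧
      (n : ℝ) - (Module.finrank F H.direction : ℝ) ≤
        Real.logb q (Z.ncard : ℝ) + (q : ℝ) * Real.logb 2 (q : ℝ) := by
  classical
  obtain ⟨z, hz⟩ := hZ
  have hq2 : 2 ≤ q := hq ▸ Fintype.one_lt_card
  have hq2' : (2 : ℝ) ≤ q := by exact_mod_cast hq2
  have hZpos : 0 < Z.ncard := (Set.ncard_pos Z.toFinite).2 ⟨z, hz⟩
  have hlog : 0 ≤ Real.logb q Z.ncard :=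
    Real.logb_nonneg (by linarith) (by exact_mod_cast hZpos)
  have hone : 1 ≤ Real.logb 2 q := by
    rw [Real.le_logb_iff_rpow_le (by norm_num) (by linarith)]
    simpa using hq2'
  let k := Nat.clog q Z.ncard
  have hk : Z.ncard ≤ q ^ k := Nat.le_pow_clog hq2 _
  have hceil : (k : ℝ) < Real.logb q Z.ncard + 1 := by
    simpa only [Real.natCeil_logb_natCast] using Nat.ceil_lt_add_one hlog
  have hcard : (((Z \ {z}).toFinset.image fun x => x - z).card) < Nat.card F ^ k := by
    rw [Nat.card_eq_fintype_card, hq]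
    refine Finset.card_image_le.trans_lt (lt_of_lt_of_le ?_ hk)
    rw [← Set.ncard_eq_toFinset_card']
    exact Set.ncard_sdiff_singleton_lt_of_mem hz
  obtain ⟨L, hL⟩ := exists_linearMap_forall_apply_ne_zero k _
    (by
      simp only [Finset.mem_image, Set.mem_toFinset, Set.mem_sdiff, Set.mem_singleton_iff]
      rintro _ ⟨x, ⟨-, hx⟩, rfl⟩
      exact sub_ne_zero.2 hx) hcard
  refine ⟨AffineSubspace.mk' z (LinearMap.ker L), ⟨z, ⟨hz, AffineSubspace.self_mem_mk' _ _⟩, ?_⟩,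
    ?_⟩
  · rintro x ⟨hx, hxH⟩
    by_contra hne
    refine hL (x - z) (Finset.mem_image_of_mem _ (by simp [hx, hne])) ?_
    simpa [AffineSubspace.mem_mk'] using hxH
  · rw [AffineSubspace.direction_mk']
    have hrank := L.finrank_range_add_finrank_ker
    have hrange := (LinearMap.range L).finrank_le
    rw [Module.finrank_fin_fun] at hrank hrange
    have hcodim : (n : ℝ) ≤ k + Module.finrank F (LinearMap.ker L) := by
      exact_mod_cast (by omega : n ≤ k + Module.finrank F (LinearMap.ker L))
    nlinarith
end

section
/- Let F be a finite field with q elements, let n ≥ 1, and let Z be a finite subset of F^n that contains q linearly independent vectors (i.e. there is w : Fin q → F^n with every w i ∈ Z and the family w linearly independent over F). Then there exist a linear functional φ : F^n → F and a scalar c ∈ F such that the fiber {z ∈ Z : φ(z) = c} is nonempty and q · |{z ∈ Z : φ(z) = c}| ≤ |Z|. -/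
/-- A linear map can be prescribed arbitrarily on a linearly independent family. -/
theorem LinearIndependent.exists_linearMap_apply_eq {ι K V W : Type*} [DivisionRing K]
    [AddCommGroup V] [Module K V] [AddCommGroup W] [Module K W] {v : ι → V}
    (hv : LinearIndependent K v) (f : ι → W) : ∃ φ : V →ₗ[K] W, ∀ i, φ (v i) = f i := by
  obtain ⟨φ, hφ⟩ := ((Module.Basis.span hv).constr ℕ f).exists_extend
  refine ⟨φ, fun i => ?_⟩
  have h := LinearMap.congr_fun hφ (Module.Basis.span hv i)
  rwa [Module.Basis.constr_basis, LinearMap.comp_apply, Submodule.subtype_apply,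
    Module.Basis.span_apply] at h

/-- Let `F` be a finite field with `q` elements, `n ≥ 1`, and let
`Z ⊆ F^n` contain `q` linearly independent vectors.  Then there are a linear functional
`φ : F^n → F` and a scalar `c` such that the fiber `{z ∈ Z | φ z = c}` is nonempty and
`q · |{z ∈ Z | φ z = c}| ≤ |Z|`. -/
theorem exists_hyperplane_small_nonempty_fiber
    {F : Type*} [Field F] [Fintype F] (q : ℕ) (hq : Fintype.card F = q)
    (n : ℕ) (hn : 1 ≤ n) (Z : Set (Fin n → F))
    (hw : ∃ w : Fin q → (Fin n → F), (∀ i, w i ∈ Z) ∧ LinearIndependent F w) :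
    ∃ (φ : (Fin n → F) →ₗ[F] F) (c : F),
      {z ∈ Z | φ z = c}.Nonempty ∧ q * {z ∈ Z | φ z = c}.ncard ≤ Z.ncard := by
  subst hq
  obtain ⟨w, hwZ, hli⟩ := hw
  obtain ⟨φ, hφ⟩ := hli.exists_linearMap_apply_eq (Fintype.equivFin F).symm
  have hne (c : F) : {z ∈ Z | φ z = c}.Nonempty :=
    ⟨w (Fintype.equivFin F c), hwZ _, by simp [hφ]⟩
  have hsum : Z.ncard = ∑ c : F, {z ∈ Z | φ z = c}.ncard := by
    classical
    rw [Set.ncard_eq_toFinset_card' Z,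
      Finset.card_eq_sum_card_fiberwise (f := φ) (t := Finset.univ) (by simp)]
    refine Finset.sum_congr rfl fun c _ => ?_
    rw [Set.ncard_eq_toFinset_card']
    congr 1
    ext z
    simp
  obtain ⟨c, -, hc⟩ := Finset.exists_min_image Finset.univ
    (fun c : F => {z ∈ Z | φ z = c}.ncard) Finset.univ_nonempty
  refine ⟨φ, c, hne c, ?_⟩
  rw [hsum]
  simpa using Finset.card_nsmul_le_sum Finset.univ _ _ hc
end

section
/- Fix h ≥ 1 and primes p₁, …, p_h, and let D, the operations e_j, v_j, and the relations θ_k be as defined. Then for every k with 1 ≤ k ≤ h+1, the relation θ_k is a congruence of D (an equivalence relation compatible with +, with every e_j, and with every v_j), and these congruences form a strictly increasing chain θ₁ < θ₂ < … < θ_h < θ_{h+1}, where θ₁ is the equality relation and θ_{h+1} is the total relation. -/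
/-- The operation `e_j` on `D = Z_{p 0} × ⋯ × Z_{p (h-1)}`: keep the `j`-th coordinate
and set all other coordinates to `0`. -/
def eOp {h : ℕ} {p : Fin h → ℕ} (j : Fin h) (x : ∀ i, ZMod (p i)) : ∀ i, ZMod (p i) :=
  fun i => if i = j then x i else 0

/-- The operation `v_j` on `D`: put `b_j (x_{j+1})` in coordinate `j` and `0` elsewhere,
where `b_j` sends `0` to `0` and every nonzero element to `1`. -/
def vOp {h : ℕ} {p : Fin h → ℕ} (j : Fin h) (hj : (j : ℕ) + 1 < h)
    (x : ∀ i, ZMod (p i)) : ∀ i, ZMod (p i) :=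
  fun i => if i = j then (if x ⟨(j : ℕ) + 1, hj⟩ = 0 then 0 else 1) else 0

/-- The relation `θ_k` on `D` (for `1 ≤ k ≤ h + 1`): `a θ_k b` iff the coordinates of `a`
and `b` agree from position `k` on (coordinates are `1`-indexed as in the paper, so the
`0`-indexed coordinate `i` corresponds to position `i + 1`). -/
def theta {h : ℕ} (p : Fin h → ℕ) (k : ℕ) (a b : ∀ i, ZMod (p i)) : Prop :=
  ∀ i : Fin h, k ≤ (i : ℕ) + 1 → a i = b i

/-- A congruence of the algebra `D`: an equivalence relation compatible with `+`, with
every `e_j` and with every `v_j`. -/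
def IsCongruence {h : ℕ} (p : Fin h → ℕ)
    (r : (∀ i, ZMod (p i)) → (∀ i, ZMod (p i)) → Prop) : Prop :=
  Equivalence r ∧
    (∀ a a' b b', r a a' → r b b' → r (a + b) (a' + b')) ∧
    (∀ j : Fin h, ∀ a a', r a a' → r (eOp j a) (eOp j a')) ∧
    (∀ (j : Fin h) (hj : (j : ℕ) + 1 < h), ∀ a a', r a a' → r (vOp j hj a) (vOp j hj a'))

theorem theta_isCongruence {h : ℕ} (p : Fin h → ℕ) (k : ℕ) : IsCongruence p (theta p k) := by
  refine ⟨⟨fun a i _ => rfl, fun hab i hi => (hab i hi).symm,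
    fun hab hbc i hi => (hab i hi).trans (hbc i hi)⟩, ?_, ?_, ?_⟩
  · intro a a' b b' ha hb i hi
    simp only [Pi.add_apply, ha i hi, hb i hi]
  · intro j a a' ha i hi
    simp only [eOp, ha i hi]
  · intro j hj a a' ha i hi
    by_cases hij : i = j
    · subst hij
      simp only [vOp, ha ⟨(i : ℕ) + 1, hj⟩ (Nat.le_succ_of_le hi)]
    · simp only [vOp, if_neg hij]

theorem theta_mono {h : ℕ} (p : Fin h → ℕ) {k l : ℕ} (hkl : k ≤ l) {a b : ∀ i, ZMod (p i)}
    (hab : theta p k a b) : theta p l a b :=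
  fun i hi => hab i (hkl.trans hi)

theorem theta_one_iff {h : ℕ} (p : Fin h → ℕ) (a b : ∀ i, ZMod (p i)) :
    theta p 1 a b ↔ a = b :=
  ⟨fun hab => funext fun i => hab i (Nat.le_add_left 1 i), fun hab i _ => congrFun hab i⟩

theorem theta_total {h : ℕ} (p : Fin h → ℕ) (a b : ∀ i, ZMod (p i)) : theta p (h + 1) a b :=
  fun i hi => absurd i.isLt (by lia)

/-- The unit vector at coordinate `j` is related to `0` by `θ_{j+2}` but not by `θ_{j+1}`. -/
theorem not_theta_succ_le {h : ℕ} (p : Fin h → ℕ) (j : Fin h) (hj : p j ≠ 1) :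
    ¬ ∀ a b, theta p ((j : ℕ) + 1 + 1) a b → theta p ((j : ℕ) + 1) a b := by
  intro H
  have : Nontrivial (ZMod (p j)) := ZMod.nontrivial_iff.mpr hj
  have h1 := H (Pi.single j 1) 0 (fun i hi => Pi.single_eq_of_ne (by rintro rfl; lia) 1) j le_rfl
  rw [Pi.single_eq_same] at h1
  exact one_ne_zero h1

/-- Fix `h ≥ 1` and primes `p 0, …, p (h-1)`.  For every `1 ≤ k ≤ h+1`
the relation `θ_k` is a congruence of `D`, `θ_1` is equality, `θ_{h+1}` is total, and the
`θ_k` form a strictly increasing chain `θ_1 < θ_2 < … < θ_{h+1}`. -/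
theorem theta_congruences_chain
    (h : ℕ) (hh : 1 ≤ h) (p : Fin h → ℕ) (hp : ∀ i, (p i).Prime) :
    (∀ k, 1 ≤ k → k ≤ h + 1 → IsCongruence p (theta p k)) ∧
    (∀ a b, theta p 1 a b ↔ a = b) ∧
    (∀ a b, theta p (h + 1) a b) ∧
    (∀ k, 1 ≤ k → k ≤ h →
      (∀ a b, theta p k a b → theta p (k + 1) a b) ∧
        ¬ (∀ a b, theta p (k + 1) a b → theta p k a b)) := by
  refine ⟨fun k _ _ => theta_isCongruence p k, theta_one_iff p, theta_total p,
    fun k hk hkh => ⟨fun a b => theta_mono p k.le_succ, ?_⟩⟩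
  obtain ⟨j, rfl⟩ := Nat.exists_eq_add_of_le' hk
  exact not_theta_succ_le p ⟨j, hkh⟩ (hp _).ne_one
end

section
/- Fix h ≥ 1 and primes p₁, …, p_h with p_i ≠ p_{i+1} for all i, and let D, the operations e_j, v_j, and the relations θ_k be as defined. Then every congruence of D (every equivalence relation on D compatible with +, with every e_j, and with every v_j) is equal to θ_k for some k with 1 ≤ k ≤ h+1. -/
namespace IsCongruence

variable {h : ℕ} {p : Fin h → ℕ} {r : (∀ i, ZMod (p i)) → (∀ i, ZMod (p i)) → Prop}

theorem rel_iff_rel_zero_sub (hr : IsCongruence p r) (a b : ∀ i, ZMod (p i)) :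
    r a b ↔ r 0 (b - a) := by
  obtain ⟨heq, hadd, -, -⟩ := hr
  constructor
  · intro hab
    simpa [sub_eq_add_neg] using hadd _ _ _ _ hab (heq.refl (-a))
  · intro hab
    simpa using hadd _ _ _ _ hab (heq.refl a)

/-- The congruence class of `0`, as an additive subgroup. -/
def zeroClass (hr : IsCongruence p r) : AddSubgroup (∀ i, ZMod (p i)) where
  carrier := {x | r 0 x}
  zero_mem' := hr.1.refl 0
  add_mem' {a b} ha hb := by simpa using hr.2.1 _ _ _ _ ha hb
  neg_mem' {a} ha := by
    simpa using (hr.rel_iff_rel_zero_sub a 0).1 (hr.1.symm ha)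

theorem mem_zeroClass (hr : IsCongruence p r) {x : ∀ i, ZMod (p i)} :
    x ∈ hr.zeroClass ↔ r 0 x := Iff.rfl

theorem single_mem_zeroClass (hr : IsCongruence p r) (hp : ∀ i, (p i).Prime) {i : Fin h}
    {x : ∀ i, ZMod (p i)} (hx : x ∈ hr.zeroClass) (hxi : x i ≠ 0) (c : ZMod (p i)) :
    Pi.single i c ∈ hr.zeroClass := by
  have : Fact (p i).Prime := ⟨hp i⟩
  have he : eOp i x ∈ hr.zeroClass := by
    have hzero : eOp i (0 : ∀ i, ZMod (p i)) = 0 := by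
      funext j
      simp [eOp]
    have hrel := hr.2.2.1 i 0 x hx
    rwa [hzero] at hrel
  convert nsmul_mem he (c / x i).val using 1
  funext j
  by_cases hj : j = i
  · subst hj
    simp [eOp, hxi]
  · simp [eOp, hj]

theorem single_one_mem_zeroClass (hr : IsCongruence p r) {i : Fin h} (hi : (i : ℕ) + 1 < h)
    {x : ∀ i, ZMod (p i)} (hx : x ∈ hr.zeroClass) (hxi : x ⟨(i : ℕ) + 1, hi⟩ ≠ 0) :
    Pi.single i 1 ∈ hr.zeroClass := by
  have hzero : vOp i hi (0 : ∀ i, ZMod (p i)) = 0 := by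
    funext j
    simp [vOp]
  have hone : vOp i hi x = Pi.single i 1 := by
    funext j
    by_cases hj : j = i
    · subst hj
      simp [vOp, hxi]
    · simp [vOp, hj]
  have hrel := hr.2.2.2 i hi 0 x hx
  rwa [hzero, hone] at hrel

theorem exists_mem_zeroClass_of_le (hr : IsCongruence p r) (hp : ∀ i, (p i).Prime)
    {i j : Fin h} (hij : i ≤ j) (hj : ∃ x ∈ hr.zeroClass, x j ≠ 0) :
    ∃ x ∈ hr.zeroClass, x i ≠ 0 := by
  obtain ⟨j, hjh⟩ := j
  have hle : (i : ℕ) ≤ j := hij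
  clear hij
  induction j, hle using Nat.le_induction with
  | base => exact hj
  | succ n _ ih =>
    obtain ⟨x, hx, hxn⟩ := hj
    have hn : n < h := by omega
    have : Fact (p ⟨n, hn⟩).Prime := ⟨hp _⟩
    refine ih hn ⟨_, hr.single_one_mem_zeroClass (i := ⟨n, hn⟩) hjh hx hxn, ?_⟩
    simp

end IsCongruence

/-- Fix `h ≥ 1` and primes `p 0, …, p (h-1)` with consecutive primes
distinct.  Then every congruence of `D` equals `θ_k` for some `1 ≤ k ≤ h + 1`. -/
theorem congruences_eq_theta
    (h : ℕ) (hh : 1 ≤ h) (p : Fin h → ℕ) (hp : ∀ i, (p i).Prime)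
    (halt : ∀ (i : Fin h) (hi : (i : ℕ) + 1 < h), p i ≠ p ⟨(i : ℕ) + 1, hi⟩)
    (r : (∀ i, ZMod (p i)) → (∀ i, ZMod (p i)) → Prop) (hr : IsCongruence p r) :
    ∃ k, 1 ≤ k ∧ k ≤ h + 1 ∧ ∀ a b, r a b ↔ theta p k a b := by
  classical
  have hex : ∃ k, 1 ≤ k ∧ ∀ i : Fin h, k ≤ (i : ℕ) + 1 → ∀ x ∈ hr.zeroClass, x i = 0 :=
    ⟨h + 1, by omega, fun i hi => absurd i.isLt (by omega)⟩
  obtain ⟨hk, hvanish⟩ := Nat.find_spec hex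
  refine ⟨Nat.find hex, hk,
    Nat.find_min' hex ⟨by omega, fun i hi => absurd i.isLt (by omega)⟩, fun a b => ?_⟩
  rw [hr.rel_iff_rel_zero_sub, ← hr.mem_zeroClass]
  constructor
  · intro hab i hi
    exact (sub_eq_zero.1 (hvanish i hi _ hab)).symm
  · intro hab
    rw [← Finset.univ_sum_single (b - a)]
    refine sum_mem fun i _ => ?_
    by_cases hi : Nat.find hex ≤ (i : ℕ) + 1
    · simp [hab i hi]
    · have hmin := Nat.find_min hex (not_le.1 hi)
      push Not at hmin
      obtain ⟨j, hij, hj⟩ := hmin (by omega)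
      obtain ⟨x, hx, hxi⟩ :=
        hr.exists_mem_zeroClass_of_le hp (Fin.le_def.2 (by omega : (i : ℕ) ≤ j)) hj
      exact hr.single_mem_zeroClass hp hx hxi _
end
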